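/- Let s ≥ 2 be an integer, and fix A_k ∈ Sym^k(V,W) for 1 ≤ k ≤ s−1 such that A₁ : V → W is injective. Then the map A_s ↦ τ_{A₁,…,A_{s−1},A_s} is a surjection from Sym^s(V,W) onto T_s(V): for every τ ∈ T_s(V) there exists a symmetric s-linear map A_s : V^s → W with τ_{A₁,…,A_s} = τ. -/

import Mathlib

/-- The index in `Fin (s+1)` corresponding to the `t`-th "middle" argument
(`t : Fin (s-1)` corresponds to the argument `v_{t+1}`). -/
def midIdx {s : ℕ} (t : Fin (s - 1)) : Fin (s + 1) :=
  ⟨t.val + 1, Nat.succ_lt_succ (lt_of_lt_of_le t.isLt (Nat.sub_le s 1))⟩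

/-- The `(s+1)`-linear form `τ_{A₁,…,A_s}` of the paper, defined by
`τ(v₀,…,v_s) = ∑_{T ⊆ {1,…,s-1}} ω(A_{|T|+1}(v₀, v_T), A_{s-|T|}(v_{Tᶜ}, v_s))`,
where the elements of `T` and of its complement are listed in increasing order. -/
noncomputable def tauForm {V W : Type*} [AddCommGroup V] [Module ℝ V]
    [AddCommGroup W] [Module ℝ W]
    (ω : W →ₗ[ℝ] W →ₗ[ℝ] ℝ) (s : ℕ)
    (A : (k : ℕ) → MultilinearMap ℝ (fun _ : Fin k => V) W)
    (v : Fin (s + 1) → V) : ℝ :=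
  ∑ T : Finset (Fin (s - 1)),
    ω (A (T.card + 1) (Fin.cons (v 0)
        (fun i => v (midIdx ((T.orderIsoOfFin rfl i : Fin (s - 1)))))))
      (A (s - T.card) (fun i =>
        if h : (i : ℕ) < Tᶜ.card then
          v (midIdx ((Tᶜ.orderIsoOfFin rfl ⟨(i : ℕ), h⟩ : Fin (s - 1))))
        else v (Fin.last s)))

open Finset

section BlockEval

variable {V W ι : Type*} [AddCommGroup V] [Module ℝ V] [AddCommGroup W] [Module ℝ W]
  [LinearOrder ι]

/-- The multilinear map of degree `#U` evaluated on the vectors indexed by `U`. -/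
noncomputable def blockEval (A : (k : ℕ) → MultilinearMap ℝ (fun _ : Fin k => V) W)
    (U : Finset ι) (v : ι → V) : W :=
  A U.card (fun i => v (U.orderEmbOfFin rfl i))

/-- The maps `A k` with `1 ≤ k ≤ s` are symmetric. -/
def SymmUpTo (s : ℕ) (A : (k : ℕ) → MultilinearMap ℝ (fun _ : Fin k => V) W) : Prop :=
  ∀ k : ℕ, 1 ≤ k → k ≤ s → ∀ (σ : Equiv.Perm (Fin k)) (m : Fin k → V),
    A k (fun i => m (σ i)) = A k m

variable {A : (k : ℕ) → MultilinearMap ℝ (fun _ : Fin k => V) W} {s : ℕ}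

theorem SymmUpTo.apply_eq_blockEval (hA : SymmUpTo s A) {k : ℕ} (hk : 1 ≤ k) (hks : k ≤ s)
    {U : Finset ι} {f : Fin k → ι} (hf : Function.Injective f)
    (hU : ∀ x, x ∈ U ↔ ∃ i, f i = x) (v : ι → V) :
    A k (fun i => v (f i)) = blockEval A U v := by
  have hcard : U.card = k := by
    have : U = univ.image f := by ext x; simp [hU]
    rw [this, card_image_of_injective _ hf, card_univ, Fintype.card_fin]
  subst hcard
  have hmem : ∀ i, f i ∈ U := fun i => (hU _).2 ⟨i, rfl⟩
  let g : Fin U.card → Fin U.card := fun i => (U.orderIsoOfFin rfl).symm ⟨f i, hmem i⟩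
  have hg : Function.Injective g := fun i j hij => by
    simpa [g, hf.eq_iff] using hij
  let σ : Equiv.Perm (Fin U.card) := Equiv.ofBijective g (Finite.injective_iff_bijective.1 hg)
  refine Eq.trans ?_ (hA _ hk hks σ _)
  congr 1
  funext i
  simp [σ, g, ← Finset.coe_orderIsoOfFin_apply]

theorem SymmUpTo.blockEval_comp (hA : SymmUpTo s A) {U : Finset ι} (hU : U.Nonempty)
    (hUs : U.card ≤ s) (σ : Equiv.Perm ι) (v : ι → V) :
    blockEval A U (fun i => v (σ i)) = blockEval A (U.map σ.toEmbedding) v := by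
  refine hA.apply_eq_blockEval (f := fun i => σ (U.orderEmbOfFin rfl i))
    (card_pos.2 hU) hUs (σ.injective.comp (U.orderEmbOfFin rfl).injective) (fun x => ?_) v
  constructor
  · intro hx
    obtain ⟨y, hy, rfl⟩ := mem_map.1 hx
    rw [← mem_coe, ← range_orderEmbOfFin U rfl] at hy
    obtain ⟨i, rfl⟩ := hy
    exact ⟨i, rfl⟩
  · rintro ⟨i, rfl⟩
    exact mem_map_of_mem _ (orderEmbOfFin_mem U rfl i)

theorem blockEval_update_of_notMem {U : Finset ι} {i : ι} (hi : i ∉ U) (v : ι → V) (x : V) :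
    blockEval A U (Function.update v i x) = blockEval A U v := by
  unfold blockEval
  congr 1
  funext j
  rw [Function.update_of_ne]
  rintro rfl
  exact hi (orderEmbOfFin_mem U rfl j)

theorem exists_blockEval_update {U : Finset ι} {i : ι} (hi : i ∈ U) (v : ι → V) :
    ∃ j : Fin U.card, ∀ x : V, blockEval A U (Function.update v i x) =
      A U.card (Function.update (fun l => v (U.orderEmbOfFin rfl l)) j x) := by
  rw [← mem_coe, ← range_orderEmbOfFin U rfl] at hi
  obtain ⟨j, rfl⟩ := hi
  refine ⟨j, fun x => ?_⟩
  unfold blockEval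
  congr 1
  exact Function.update_comp_eq_of_injective v (U.orderEmbOfFin rfl).injective j x

theorem blockEval_update_add {U : Finset ι} {i : ι} (hi : i ∈ U) (v : ι → V) (x y : V) :
    blockEval A U (Function.update v i (x + y)) =
      blockEval A U (Function.update v i x) + blockEval A U (Function.update v i y) := by
  obtain ⟨j, hj⟩ := exists_blockEval_update (A := A) hi v
  simp only [hj, MultilinearMap.map_update_add]

theorem blockEval_update_smul {U : Finset ι} {i : ι} (hi : i ∈ U) (v : ι → V) (c : ℝ) (x : V) :
    blockEval A U (Function.update v i (c • x)) =
      c • blockEval A U (Function.update v i x) := by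
  obtain ⟨j, hj⟩ := exists_blockEval_update (A := A) hi v
  simp only [hj, MultilinearMap.map_update_smul]

theorem blockEval_update_family_of_ne {U : Finset ι} (hU : U.card ≠ s)
    (B : MultilinearMap ℝ (fun _ : Fin s => V) W) (v : ι → V) :
    blockEval (Function.update A s B) U v = blockEval A U v := by
  rw [blockEval, Function.update_of_ne hU, blockEval]

theorem SymmUpTo.update (hA : SymmUpTo (s - 1) A) {B : MultilinearMap ℝ (fun _ : Fin s => V) W}
    (hB : ∀ (σ : Equiv.Perm (Fin s)) (m : Fin s → V), B (fun i => m (σ i)) = B m) :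
    SymmUpTo s (Function.update A s B) := by
  intro k hk hks σ m
  rcases eq_or_ne k s with rfl | hne
  · simpa using hB σ m
  · rw [Function.update_of_ne hne]
    exact hA k hk (by omega) σ m

variable [Fintype ι] (ω : W →ₗ[ℝ] W →ₗ[ℝ] ℝ)

/-- The pairing of the block `U` with the complementary block, as a multilinear form. -/
noncomputable def blockPairing (A : (k : ℕ) → MultilinearMap ℝ (fun _ : Fin k => V) W)
    (U : Finset ι) : MultilinearMap ℝ (fun _ : ι => V) ℝ :=
  MultilinearMap.mk' (fun v => ω (blockEval A U v) (blockEval A Uᶜ v))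
    (fun v i x y => by
      by_cases hi : i ∈ U
      · have hi' : i ∉ Uᶜ := by simpa using hi
        simp only [blockEval_update_add hi, blockEval_update_of_notMem hi', map_add,
          LinearMap.add_apply]
      · have hi' : i ∈ Uᶜ := by simpa using hi
        simp only [blockEval_update_add hi', blockEval_update_of_notMem hi, map_add])
    (fun v i c x => by
      by_cases hi : i ∈ U
      · have hi' : i ∉ Uᶜ := by simpa using hi
        simp only [blockEval_update_smul hi, blockEval_update_of_notMem hi', map_smul,
          LinearMap.smul_apply]
      · have hi' : i ∈ Uᶜ := by simpa using hi
        simp only [blockEval_update_smul hi', blockEval_update_of_notMem hi, map_smul])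

theorem blockPairing_apply (U : Finset ι) (v : ι → V) :
    blockPairing ω A U v = ω (blockEval A U v) (blockEval A Uᶜ v) := rfl

/-- The sum of the block pairings over all blocks containing `a` but not `b`. -/
noncomputable def separatingSum (A : (k : ℕ) → MultilinearMap ℝ (fun _ : Fin k => V) W)
    (a b : ι) : MultilinearMap ℝ (fun _ : ι => V) ℝ :=
  ∑ U : Finset ι with a ∈ U ∧ b ∉ U, blockPairing ω A U

theorem separatingSum_apply (a b : ι) (v : ι → V) :
    separatingSum ω A a b v = ∑ U : Finset ι, if a ∈ U ∧ b ∉ U then blockPairing ω A U v else 0 := by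
  rw [separatingSum, _root_.sum_apply, sum_filter]

theorem sum_eq_sum_compl (g : Finset ι → ℝ) : ∑ U, g Uᶜ = ∑ U, g U :=
  Equiv.sum_comp (compl_involutive (α := Finset ι)).toPerm g

variable {ω}

theorem blockPairing_compl (hanti : ∀ w₁ w₂ : W, ω w₁ w₂ = - ω w₂ w₁) (U : Finset ι)
    (v : ι → V) : blockPairing ω A Uᶜ v = - blockPairing ω A U v := by
  rw [blockPairing_apply, blockPairing_apply, compl_compl, hanti]

theorem separatingSum_swap (hanti : ∀ w₁ w₂ : W, ω w₁ w₂ = - ω w₂ w₁) (a b : ι) (v : ι → V) :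
    separatingSum ω A b a v = - separatingSum ω A a b v := by
  rw [separatingSum_apply, separatingSum_apply, ← sum_eq_sum_compl, ← sum_neg_distrib]
  refine sum_congr rfl fun U _ => ?_
  rw [blockPairing_compl hanti]
  by_cases ha : a ∈ U <;> by_cases hb : b ∈ U <;> simp [ha, hb]

theorem separatingSum_cyclic (hanti : ∀ w₁ w₂ : W, ω w₁ w₂ = - ω w₂ w₁) (a b c : ι)
    (v : ι → V) :
    separatingSum ω A a b v + separatingSum ω A b c v + separatingSum ω A c a v = 0 := by
  have key : separatingSum ω A a b v + separatingSum ω A b c v + separatingSum ω A c a v =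
      separatingSum ω A b a v + separatingSum ω A c b v + separatingSum ω A a c v := by
    simp only [separatingSum_apply, ← sum_add_distrib]
    refine sum_congr rfl fun U _ => ?_
    by_cases ha : a ∈ U <;> by_cases hb : b ∈ U <;> by_cases hc : c ∈ U <;> simp [ha, hb, hc]
  have h₁ := separatingSum_swap (A := A) hanti a b v
  have h₂ := separatingSum_swap (A := A) hanti b c v
  have h₃ := separatingSum_swap (A := A) hanti c a v
  linarith

theorem separatingSum_comp (hA : SymmUpTo s A) (hs : Fintype.card ι = s + 1) (a b : ι)
    (σ : Equiv.Perm ι) (v : ι → V) :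
    separatingSum ω A a b (fun i => v (σ i)) = separatingSum ω A (σ a) (σ b) v := by
  rw [separatingSum_apply, separatingSum_apply]
  refine Eq.trans ?_ (Equiv.sum_comp σ.finsetCongr
    (fun U => if σ a ∈ U ∧ σ b ∉ U then blockPairing ω A U v else 0))
  refine sum_congr rfl fun U _ => ?_
  have hmem : ∀ x, σ x ∈ σ.finsetCongr U ↔ x ∈ U := fun x => mem_map' _
  simp only [hmem]
  split_ifs with h
  · have hcard := card_add_card_compl U
    have hpos : 0 < U.card := card_pos.2 ⟨a, h.1⟩
    have hb : b ∈ Uᶜ := by simpa using h.2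
    have hpos' : 0 < Uᶜ.card := card_pos.2 ⟨b, hb⟩
    have hmap : (U.map σ.toEmbedding)ᶜ = Uᶜ.map σ.toEmbedding := by
      ext x
      simp [mem_map_equiv]
    rw [Equiv.finsetCongr_apply, blockPairing_apply, blockPairing_apply, hmap,
      hA.blockEval_comp ⟨a, h.1⟩ (by omega), hA.blockEval_comp ⟨b, hb⟩ (by omega)]
  · rfl

end BlockEval

theorem zero_ne_last_of_two_le {s : ℕ} (hs : 2 ≤ s) : (0 : Fin (s + 1)) ≠ Fin.last s := by
  simp only [ne_eq, Fin.ext_iff, Fin.val_zero, Fin.val_last]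
  omega

theorem zero_ne_one_of_two_le {s : ℕ} (hs : 2 ≤ s) : (0 : Fin (s + 1)) ≠ 1 := by
  simp only [ne_eq, Fin.ext_iff, Fin.val_zero, Fin.val_one', Nat.mod_eq_of_lt (show 1 < s + 1 by omega)]
  omega

theorem one_ne_last_of_two_le {s : ℕ} (hs : 2 ≤ s) : (1 : Fin (s + 1)) ≠ Fin.last s := by
  simp only [ne_eq, Fin.ext_iff, Fin.val_last, Fin.val_one', Nat.mod_eq_of_lt (show 1 < s + 1 by omega)]
  omega

section Symmetrization

variable {V : Type*} [AddCommGroup V] [Module ℝ V] {s : ℕ}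

theorem MultilinearMap.apply_perm_eq_of_ends {K : MultilinearMap ℝ (fun _ : Fin (s + 1) => V) ℝ}
    (h2 : ∀ (v : Fin (s + 1) → V) (σ : Equiv.Perm (Fin (s + 1))),
      σ 0 = 0 → σ (Fin.last s) = Fin.last s → K (fun i => v (σ i)) = K v)
    (v : Fin (s + 1) → V) {π ρ : Equiv.Perm (Fin (s + 1))} (h₀ : π 0 = ρ 0)
    (h₁ : π (Fin.last s) = ρ (Fin.last s)) :
    K (fun i => v (π i)) = K (fun i => v (ρ i)) := by
  have h := h2 (fun i => v (ρ i)) (ρ⁻¹ * π) (by simp [h₀]) (by simp [h₁])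
  simpa using h

/-- A form satisfying the identities defining `T_s(V)` is an antisymmetrization of a form that is
symmetric in its first `s` arguments. -/
theorem MultilinearMap.exists_symm_of_cyclic (hs : 2 ≤ s)
    (K : MultilinearMap ℝ (fun _ : Fin (s + 1) => V) ℝ)
    (h1 : ∀ v : Fin (s + 1) → V, K (fun i => v (Equiv.swap 0 (Fin.last s) i)) = - K v)
    (h2 : ∀ (v : Fin (s + 1) → V) (σ : Equiv.Perm (Fin (s + 1))),
      σ 0 = 0 → σ (Fin.last s) = Fin.last s → K (fun i => v (σ i)) = K v)
    (h3 : ∀ v : Fin (s + 1) → V,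
      K v
        + K (fun i =>
            v ((Equiv.swap (1 : Fin (s + 1)) (Fin.last s) * Equiv.swap 0 1 :
              Equiv.Perm (Fin (s + 1))) i))
        + K (fun i =>
            v ((Equiv.swap (1 : Fin (s + 1)) (Fin.last s) * Equiv.swap 0 1 :
                Equiv.Perm (Fin (s + 1)))
              ((Equiv.swap (1 : Fin (s + 1)) (Fin.last s) * Equiv.swap 0 1 :
                Equiv.Perm (Fin (s + 1))) i))) = 0) :
    ∃ B : MultilinearMap ℝ (fun _ : Fin (s + 1) => V) ℝ,
      (∀ (v : Fin (s + 1) → V) (σ : Equiv.Perm (Fin (s + 1))), σ (Fin.last s) = Fin.last s →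
        B (fun i => v (σ i)) = B v) ∧
      ∀ v : Fin (s + 1) → V, B (fun i => v (Equiv.swap 0 (Fin.last s) i)) - B v = K v := by
  have h0l := zero_ne_last_of_two_le hs
  have h01 := zero_ne_one_of_two_le hs
  have h1l := one_ne_last_of_two_le hs
  -- `q b` puts the last vector in front and the `b`-th vector at the end
  let q : Fin (s + 1) → Equiv.Perm (Fin (s + 1)) := fun b =>
    Equiv.swap 0 (Fin.last s) * Equiv.swap b (Fin.last s)
  let r : Fin (s + 1) → Equiv.Perm (Fin (s + 1)) := fun b => Equiv.swap b (Fin.last s)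
  have diff : ∀ (v : Fin (s + 1) → V) (b : Fin (s + 1)), b ≠ 0 → b ≠ Fin.last s →
      K (fun i => v (r b i)) - K (fun i => v (q b i)) = K v := by
    intro v b hb0 hbl
    have hq0 : q b 0 = Fin.last s := by
      simp [q, Equiv.swap_apply_of_ne_of_ne hb0.symm h0l]
    have hql : q b (Fin.last s) = b := by
      simp [q, Equiv.swap_apply_of_ne_of_ne hb0 hbl]
    have hr0 : r b 0 = 0 := by simp [r, Equiv.swap_apply_of_ne_of_ne hb0.symm h0l]
    have hrl : r b (Fin.last s) = b := by simp [r]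
    let t : Equiv.Perm (Fin (s + 1)) := Equiv.swap 1 b
    have ht0 : t 0 = 0 := Equiv.swap_apply_of_ne_of_ne h01 hb0.symm
    have htl : t (Fin.last s) = Fin.last s := Equiv.swap_apply_of_ne_of_ne h1l.symm hbl.symm
    have ht1 : t 1 = b := Equiv.swap_apply_left _ _
    let c : Equiv.Perm (Fin (s + 1)) := Equiv.swap 1 (Fin.last s) * Equiv.swap 0 1
    have hc0 : c 0 = Fin.last s := by simp [c]
    have hc1 : c 1 = 0 := by simp [c, Equiv.swap_apply_of_ne_of_ne h01 h0l]
    have hcl : c (Fin.last s) = 1 := by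
      simp [c, Equiv.swap_apply_of_ne_of_ne h0l.symm h1l.symm]
    have e := h3 (fun i => v (t i))
    have e₁ : K (fun i => v (t i)) = K v := h2 v t ht0 htl
    have e₂ : K (fun i => v (t (c i))) = K (fun i => v (q b i)) :=
      apply_perm_eq_of_ends h2 v (π := t * c) (by simp [hc0, htl, hq0]) (by simp [hcl, ht1, hql])
    have e₃ : K (fun i => v (t (c (c i)))) =
        K (fun i => v (r b (Equiv.swap 0 (Fin.last s) i))) :=
      apply_perm_eq_of_ends h2 v (π := t * (c * c)) (ρ := r b * Equiv.swap 0 (Fin.last s))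
        (by simp [hc0, hcl, ht1, hrl]) (by simp [hcl, hc1, ht0, hr0])
    have e₄ := h1 (fun i => v (r b i))
    change K (fun i => v (t i)) + K (fun i => v (t (c i))) + K (fun i => v (t (c (c i)))) = 0 at e
    linarith
  have hsum : ∀ v : Fin (s + 1) → V,
      ∑ b ∈ univ.erase 0, (K (fun i => v (r b i)) - K (fun i => v (q b i))) = (s + 1 : ℝ) * K v := by
    intro v
    have hmem : Fin.last s ∈ univ.erase (0 : Fin (s + 1)) := by simp [h0l.symm]
    rw [← add_sum_erase _ _ hmem, sum_congr rfl (g := fun _ => K v)]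
    · rw [sum_const, card_erase_of_mem hmem, card_erase_of_mem (mem_univ _), card_univ,
        Fintype.card_fin]
      have e := h1 v
      simp only [r, q, Equiv.swap_self, Equiv.refl_apply, Equiv.Perm.mul_apply, e, nsmul_eq_mul]
      rw [show s + 1 - 1 - 1 = s - 1 by omega, Nat.cast_sub (by omega)]
      push_cast
      ring
    · intro b hb
      simp only [mem_erase, mem_univ, and_true] at hb
      exact diff v b hb.2 hb.1
  let B : MultilinearMap ℝ (fun _ : Fin (s + 1) => V) ℝ :=
    ((s + 1 : ℝ)⁻¹) • ∑ b ∈ univ.erase 0, K.domDomCongr (q b)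
  have hB : ∀ v, B v = (s + 1 : ℝ)⁻¹ * ∑ b ∈ univ.erase 0, K (fun i => v (q b i)) := by
    intro v
    simp [B, _root_.sum_apply, MultilinearMap.domDomCongr_apply]
  refine ⟨B, fun v σ hσ => ?_, fun v => ?_⟩
  · rw [hB, hB]
    congr 1
    -- reindex by the conjugated permutation fixing `0`
    let p : Equiv.Perm (Fin (s + 1)) :=
      Equiv.swap 0 (Fin.last s) * σ * Equiv.swap 0 (Fin.last s)
    have hp0 : p 0 = 0 := by simp [p, hσ]
    refine sum_equiv p (fun b => ?_) (fun b hb => ?_)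
    · simp only [mem_erase, mem_univ, and_true]
      rw [not_iff_not]
      exact ⟨fun h => by rw [h, hp0], fun h => p.injective (h.trans hp0.symm)⟩
    · have hb0 : b ≠ 0 := by simpa using hb
      have hpb : p b ≠ 0 := fun h => hb0 (p.injective (h.trans hp0.symm))
      have hq0 : ∀ b, b ≠ 0 → q b 0 = Fin.last s := fun b hb => by
        simp [q, Equiv.swap_apply_of_ne_of_ne hb.symm h0l]
      have hql : ∀ b, q b (Fin.last s) = Equiv.swap 0 (Fin.last s) b := fun b => by simp [q]
      exact apply_perm_eq_of_ends h2 v (π := σ * q b) (by simp [hq0 b hb0, hq0 _ hpb, hσ])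
        (by simp [hql, p])
  · have hqr : ∀ b i, Equiv.swap 0 (Fin.last s) (q b i) = r b i := fun b i => by simp [q, r]
    have h := hsum v
    rw [sum_sub_distrib] at h
    rw [hB, hB]
    simp only [hqr]
    rw [← mul_sub, h]
    field_simp

end Symmetrization

section TauForm

variable {V W : Type*} [AddCommGroup V] [Module ℝ V] [AddCommGroup W] [Module ℝ W] {s : ℕ}

theorem midIdx_injective : Function.Injective (midIdx : Fin (s - 1) → Fin (s + 1)) := by
  intro i j h
  simpa [midIdx, Fin.ext_iff] using h

theorem midIdx_ne_zero (t : Fin (s - 1)) : midIdx t ≠ 0 := by simp [midIdx, Fin.ext_iff]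

theorem midIdx_ne_last (t : Fin (s - 1)) : midIdx t ≠ Fin.last s := by
  simp only [midIdx, ne_eq, Fin.ext_iff, Fin.val_last]
  omega

theorem exists_midIdx_eq {x : Fin (s + 1)} (h0 : x ≠ 0) (hl : x ≠ Fin.last s) :
    ∃ t : Fin (s - 1), midIdx t = x := by
  have h0' : (x : ℕ) ≠ 0 := fun h => h0 (Fin.ext h)
  have hl' : (x : ℕ) ≠ s := fun h => hl (Fin.ext h)
  exact ⟨⟨x - 1, by omega⟩, Fin.ext (by simp [midIdx]; omega)⟩

/-- The block of arguments consisting of the first one and the middle ones indexed by `T`. -/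
def frontBlock (T : Finset (Fin (s - 1))) : Finset (Fin (s + 1)) :=
  insert 0 (T.map ⟨midIdx, midIdx_injective⟩)

theorem mem_frontBlock {T : Finset (Fin (s - 1))} {x : Fin (s + 1)} :
    x ∈ frontBlock T ↔ x = 0 ∨ ∃ t ∈ T, midIdx t = x := by
  simp [frontBlock]

theorem midIdx_mem_frontBlock {T : Finset (Fin (s - 1))} {t : Fin (s - 1)} :
    midIdx t ∈ frontBlock T ↔ t ∈ T := by
  simp [mem_frontBlock, midIdx_ne_zero, midIdx_injective.eq_iff]

theorem last_notMem_frontBlock (hs : 2 ≤ s) (T : Finset (Fin (s - 1))) :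
    Fin.last s ∉ frontBlock T := by
  have h0l := (zero_ne_last_of_two_le hs).symm
  simp [mem_frontBlock, midIdx_ne_last, h0l]

theorem blockEval_frontBlock {A : (k : ℕ) → MultilinearMap ℝ (fun _ : Fin k => V) W}
    (hs : 2 ≤ s) (hA : SymmUpTo s A) (T : Finset (Fin (s - 1))) (v : Fin (s + 1) → V) :
    A (T.card + 1) (Fin.cons (v 0)
        (fun i => v (midIdx ((T.orderIsoOfFin rfl i : Fin (s - 1)))))) =
      blockEval A (frontBlock T) v := by
  have hT : T.card ≤ s - 1 := by simpa using card_le_univ T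
  let f : Fin (T.card + 1) → Fin (s + 1) :=
    Fin.cons 0 (fun i => midIdx (T.orderIsoOfFin rfl i : Fin (s - 1)))
  rw [← hA.apply_eq_blockEval (f := f) (by omega) (by omega)]
  · congr 1
    funext i
    refine Fin.cases ?_ (fun j => ?_) i <;> simp [f]
  · refine Fin.cons_injective_iff.2 ⟨?_, ?_⟩
    · rintro ⟨i, hi⟩
      exact midIdx_ne_zero _ hi
    · exact midIdx_injective.comp
        (Subtype.val_injective.comp (T.orderIsoOfFin rfl).injective)
  · intro x
    rw [mem_frontBlock, Fin.exists_fin_succ]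
    refine or_congr (by simp [f, eq_comm]) ⟨?_, ?_⟩
    · rintro ⟨t, ht, rfl⟩
      exact ⟨(T.orderIsoOfFin rfl).symm ⟨t, ht⟩, by simp [f, -coe_orderIsoOfFin_apply]⟩
    · rintro ⟨i, rfl⟩
      exact ⟨T.orderIsoOfFin rfl i, (T.orderIsoOfFin rfl i).2, by simp [f]⟩

theorem blockEval_compl_frontBlock {A : (k : ℕ) → MultilinearMap ℝ (fun _ : Fin k => V) W}
    (hs : 2 ≤ s) (hA : SymmUpTo s A) (T : Finset (Fin (s - 1))) (v : Fin (s + 1) → V) :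
    A (s - T.card) (fun i =>
        if h : (i : ℕ) < Tᶜ.card then
          v (midIdx ((Tᶜ.orderIsoOfFin rfl ⟨(i : ℕ), h⟩ : Fin (s - 1))))
        else v (Fin.last s)) =
      blockEval A (frontBlock T)ᶜ v := by
  have hT : T.card ≤ s - 1 := by simpa using card_le_univ T
  have hTc : Tᶜ.card = s - 1 - T.card := by simp [card_compl]
  let f : Fin (s - T.card) → Fin (s + 1) := fun i =>
    if h : (i : ℕ) < Tᶜ.card then midIdx (Tᶜ.orderIsoOfFin rfl ⟨(i : ℕ), h⟩ : Fin (s - 1))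
    else Fin.last s
  rw [← hA.apply_eq_blockEval (f := f) (by omega) (by omega)]
  · congr 1
    funext i
    simp only [f]
    split_ifs <;> rfl
  · intro i j hij
    simp only [f] at hij
    split_ifs at hij with hi hj hj
    · have := (Tᶜ.orderIsoOfFin rfl).injective (Subtype.val_injective (midIdx_injective hij))
      simpa [Fin.ext_iff] using this
    · exact absurd hij (midIdx_ne_last _)
    · exact absurd hij.symm (midIdx_ne_last _)
    · ext; omega
  · intro x
    rw [mem_compl]
    constructor
    · intro hx
      by_cases hl : x = Fin.last s
      · exact ⟨⟨Tᶜ.card, by omega⟩, by simp [f, hl]⟩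
      · obtain ⟨t, rfl⟩ := exists_midIdx_eq
          (fun h => hx (mem_frontBlock.2 (Or.inl h))) hl
        have ht : t ∈ Tᶜ := mem_compl.2 fun h => hx (midIdx_mem_frontBlock.2 h)
        have hlt := ((Tᶜ.orderIsoOfFin rfl).symm ⟨t, ht⟩).2
        refine ⟨⟨(Tᶜ.orderIsoOfFin rfl).symm ⟨t, ht⟩, by omega⟩, ?_⟩
        simp [f, -coe_orderIsoOfFin_apply]
    · rintro ⟨i, rfl⟩
      simp only [f]
      split_ifs with h
      · rw [midIdx_mem_frontBlock]
        exact mem_compl.1 (Tᶜ.orderIsoOfFin rfl ⟨(i : ℕ), h⟩).2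
      · exact last_notMem_frontBlock hs T

theorem tauForm_eq_separatingSum {A : (k : ℕ) → MultilinearMap ℝ (fun _ : Fin k => V) W}
    (ω : W →ₗ[ℝ] W →ₗ[ℝ] ℝ) (hs : 2 ≤ s) (hA : SymmUpTo s A) (v : Fin (s + 1) → V) :
    tauForm ω s A v = separatingSum ω A 0 (Fin.last s) v := by
  rw [tauForm, separatingSum, _root_.sum_apply]
  refine sum_nbij' frontBlock (fun U => univ.filter fun t => midIdx t ∈ U) ?_ ?_ ?_ ?_ ?_
  · intro T _
    simpa using ⟨mem_frontBlock.2 (Or.inl rfl), last_notMem_frontBlock hs T⟩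
  · simp
  · intro T _
    ext t
    simp [midIdx_mem_frontBlock]
  · intro U hU
    obtain ⟨h0, hl⟩ : 0 ∈ U ∧ Fin.last s ∉ U := by simpa using hU
    ext x
    simp only [mem_frontBlock, mem_filter, mem_univ, true_and]
    constructor
    · rintro (rfl | ⟨t, ht, rfl⟩) <;> assumption
    · intro hx
      by_cases hx0 : x = 0
      · exact Or.inl hx0
      · obtain ⟨t, rfl⟩ := exists_midIdx_eq hx0 (fun h => hl (h ▸ hx))
        exact Or.inr ⟨t, hx, rfl⟩
  · intro T _
    rw [blockPairing_apply, blockEval_frontBlock hs hA, blockEval_compl_frontBlock hs hA]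

/-- The dependence of the sum of block pairings on the map of top degree. -/
theorem separatingSum_update {A : (k : ℕ) → MultilinearMap ℝ (fun _ : Fin k => V) W}
    (ω : W →ₗ[ℝ] W →ₗ[ℝ] ℝ) (hs : 2 ≤ s) (hA : SymmUpTo (s - 1) A)
    {B : MultilinearMap ℝ (fun _ : Fin s => V) W}
    (hB : ∀ (σ : Equiv.Perm (Fin s)) (m : Fin s → V), B (fun i => m (σ i)) = B m)
    (v : Fin (s + 1) → V) :
    separatingSum ω (Function.update A s B) 0 (Fin.last s) v =
      separatingSum ω (Function.update A s 0) 0 (Fin.last s) v +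
        ω (A 1 fun _ => v 0) (B fun i => v i.succ) +
        ω (B fun i => v i.castSucc) (A 1 fun _ => v (Fin.last s)) := by
  have h0l := zero_ne_last_of_two_le hs
  have top : ∀ {C : MultilinearMap ℝ (fun _ : Fin s => V) W},
      (∀ (σ : Equiv.Perm (Fin s)) (m : Fin s → V), C (fun i => m (σ i)) = C m) →
      blockEval (Function.update A s C) {0}ᶜ v = C (fun i => v i.succ) ∧
      blockEval (Function.update A s C) {Fin.last s}ᶜ v = C (fun i => v i.castSucc) := by
    intro C hC
    constructor
    · rw [← (hA.update hC).apply_eq_blockEval (f := Fin.succ) (by omega) le_rfl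
        (Fin.succ_injective s) (by simp [Fin.exists_succ_eq]), Function.update_self]
    · rw [← (hA.update hC).apply_eq_blockEval (f := Fin.castSucc) (by omega) le_rfl
        (Fin.castSucc_injective s) (by simp [Fin.exists_castSucc_eq]), Function.update_self]
  have single : ∀ (C : MultilinearMap ℝ (fun _ : Fin s => V) W) (x : Fin (s + 1)),
      blockEval (Function.update A s C) {x} v = A 1 fun _ => v x := by
    intro C x
    rw [blockEval_update_family_of_ne (by simp; omega),
      ← hA.apply_eq_blockEval (f := fun _ : Fin 1 => x) le_rfl (by omega)
        (fun _ _ _ => Subsingleton.elim _ _) (by simp [eq_comm])]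
  have hne : ({0} : Finset (Fin (s + 1))) ≠ {Fin.last s}ᶜ := by
    intro h
    have := congrArg card h
    simp [card_compl] at this
    omega
  have hm₁ : ({0} : Finset (Fin (s + 1))) ∈
      univ.filter fun U : Finset (Fin (s + 1)) => 0 ∈ U ∧ Fin.last s ∉ U := by
    simp [h0l.symm]
  have hm₂ : ({Fin.last s}ᶜ : Finset (Fin (s + 1))) ∈
      (univ.filter fun U : Finset (Fin (s + 1)) => 0 ∈ U ∧ Fin.last s ∉ U).erase {0} := by
    simp [h0l, hne.symm]
  have hrest : ∀ U ∈ ((univ.filter fun U : Finset (Fin (s + 1)) =>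
      0 ∈ U ∧ Fin.last s ∉ U).erase {0}).erase {Fin.last s}ᶜ,
      blockPairing ω (Function.update A s B) U v = blockPairing ω (Function.update A s 0) U v := by
    intro U hU
    simp only [mem_erase, mem_filter, mem_univ, true_and] at hU
    obtain ⟨hU₂, hU₁, h0, hl⟩ := hU
    have hcard := card_add_card_compl U
    rw [Fintype.card_fin] at hcard
    have c₁ : U.card ≠ s := by
      intro h
      obtain ⟨x, hx⟩ := card_eq_one.1 (show Uᶜ.card = 1 by omega)
      have hxl : Fin.last s ∈ Uᶜ := by simpa using hl
      rw [hx, mem_singleton] at hxl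
      exact hU₂ (by rw [hxl, ← hx, compl_compl])
    have c₂ : Uᶜ.card ≠ s := by
      intro h
      obtain ⟨x, hx⟩ := card_eq_one.1 (show U.card = 1 by omega)
      rw [hx, mem_singleton] at h0
      exact hU₁ (by rw [h0, ← hx])
    simp only [blockPairing_apply, blockEval_update_family_of_ne c₁,
      blockEval_update_family_of_ne c₂]
  simp only [separatingSum, _root_.sum_apply]
  rw [← add_sum_erase _ _ hm₁, ← add_sum_erase _ _ hm₂, sum_congr rfl hrest,
    ← add_sum_erase _ (fun U => blockPairing ω (Function.update A s 0) U v) hm₁,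
    ← add_sum_erase _ (fun U => blockPairing ω (Function.update A s 0) U v) hm₂]
  simp only [blockPairing_apply, compl_compl, single, (top hB).1, (top hB).2,
    (top (C := 0) (by simp)).1, (top (C := 0) (by simp)).2, _root_.zero_apply, map_zero,
    LinearMap.zero_apply]
  ring

end TauForm

/-- Pairing with an injective linear map admits a linear section on the dual. -/
theorem exists_dual_section {V W : Type*} [AddCommGroup V] [Module ℝ V]
    [AddCommGroup W] [Module ℝ W] [FiniteDimensional ℝ W]
    {ω : W →ₗ[ℝ] W →ₗ[ℝ] ℝ} (hanti : ∀ w₁ w₂ : W, ω w₁ w₂ = - ω w₂ w₁)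
    (hnond : ∀ w : W, (∀ w' : W, ω w w' = 0) → w = 0)
    {a : V →ₗ[ℝ] W} (ha : Function.Injective a) :
    ∃ g : (V →ₗ[ℝ] ℝ) →ₗ[ℝ] W, ∀ φ x, ω (a x) (g φ) = φ x := by
  have hinj : Function.Injective ω.flip := by
    rw [injective_iff_map_eq_zero]
    intro w hw
    refine hnond w fun w' => ?_
    rw [hanti, neg_eq_zero]
    exact LinearMap.congr_fun hw w'
  have hsurj : Function.Surjective ω.flip :=
    (LinearMap.injective_iff_surjective_of_finrank_eq_finrank
      (Subspace.dual_finrank_eq (K := ℝ) (V := W)).symm).1 hinj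
  obtain ⟨g, hg⟩ := LinearMap.exists_rightInverse_of_surjective (a.dualMap ∘ₗ ω.flip)
    (LinearMap.range_eq_top.2 ((LinearMap.dualMap_surjective_of_injective ha).comp hsurj))
  exact ⟨g, fun φ x => LinearMap.congr_fun (LinearMap.congr_fun hg φ) x⟩

/-- if `A₁,…,A_{s-1}` are fixed symmetric multilinear maps with `A₁`
injective, then `A_s ↦ τ_{A₁,…,A_s}` surjects onto `T_s(V)`: every `(s+1)`-linear
form `τ` satisfying the identities (i), (ii), (iii) arises as `τ_{A₁,…,A_s}` for some
symmetric `s`-linear `A_s`. -/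
theorem stmt8 {V W : Type*} [AddCommGroup V] [Module ℝ V]
    [AddCommGroup W] [Module ℝ W] [FiniteDimensional ℝ V] [FiniteDimensional ℝ W]
    (ω : W →ₗ[ℝ] W →ₗ[ℝ] ℝ)
    (hanti : ∀ w₁ w₂ : W, ω w₁ w₂ = - ω w₂ w₁)
    (hnond : ∀ w : W, (∀ w' : W, ω w w' = 0) → w = 0)
    (s : ℕ) (hs : 2 ≤ s)
    (A : (k : ℕ) → MultilinearMap ℝ (fun _ : Fin k => V) W)
    (hAsym : ∀ k : ℕ, 1 ≤ k → k ≤ s - 1 → ∀ (σ : Equiv.Perm (Fin k)) (m : Fin k → V),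
      A k (fun i => m (σ i)) = A k m)
    (hA1 : Function.Injective fun x : V => A 1 (fun _ => x))
    (τ : MultilinearMap ℝ (fun _ : Fin (s + 1) => V) ℝ)
    (hτ1 : ∀ v : Fin (s + 1) → V,
      τ (fun i => v (Equiv.swap 0 (Fin.last s) i)) = - τ v)
    (hτ2 : ∀ (v : Fin (s + 1) → V) (σ : Equiv.Perm (Fin (s + 1))),
      σ 0 = 0 → σ (Fin.last s) = Fin.last s → τ (fun i => v (σ i)) = τ v)
    (hτ3 : ∀ v : Fin (s + 1) → V,
      τ v
        + τ (fun i =>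
            v ((Equiv.swap (1 : Fin (s + 1)) (Fin.last s) * Equiv.swap 0 1 :
              Equiv.Perm (Fin (s + 1))) i))
        + τ (fun i =>
            v ((Equiv.swap (1 : Fin (s + 1)) (Fin.last s) * Equiv.swap 0 1 :
                Equiv.Perm (Fin (s + 1)))
              ((Equiv.swap (1 : Fin (s + 1)) (Fin.last s) * Equiv.swap 0 1 :
                Equiv.Perm (Fin (s + 1))) i))) = 0) :
    ∃ As : MultilinearMap ℝ (fun _ : Fin s => V) W,
      (∀ (σ : Equiv.Perm (Fin s)) (m : Fin s → V), As (fun i => m (σ i)) = As m) ∧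
      ∀ v : Fin (s + 1) → V, tauForm ω s (Function.update A s As) v = τ v := by
  have hA : SymmUpTo (s - 1) A := hAsym
  let A₀ := Function.update A s 0
  have hA₀ : SymmUpTo s A₀ := hA.update (by simp)
  let R := separatingSum ω A₀ 0 (Fin.last s)
  have h0l := zero_ne_last_of_two_le hs
  have h01 := zero_ne_one_of_two_le hs
  have h1l := one_ne_last_of_two_le hs
  have hR : ∀ (σ : Equiv.Perm (Fin (s + 1))) (v : Fin (s + 1) → V),
      R (fun i => v (σ i)) = separatingSum ω A₀ (σ 0) (σ (Fin.last s)) v :=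
    fun σ v => separatingSum_comp hA₀ (Fintype.card_fin _) 0 (Fin.last s) σ v
  obtain ⟨B, hBsym, hB⟩ := MultilinearMap.exists_symm_of_cyclic hs (τ - R)
    (fun v => by
      simp only [_root_.sub_apply]
      rw [hτ1, hR, Equiv.swap_apply_left, Equiv.swap_apply_right, separatingSum_swap hanti]
      ring)
    (fun v σ h₀ h₁ => by
      simp only [_root_.sub_apply]
      rw [hτ2 v σ h₀ h₁, hR, h₀, h₁])
    (fun v => by
      set c : Equiv.Perm (Fin (s + 1)) := Equiv.swap 1 (Fin.last s) * Equiv.swap 0 1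
      have hc0 : c 0 = Fin.last s := by simp [c]
      have hc1 : c 1 = 0 := by simp [c, Equiv.swap_apply_of_ne_of_ne h01 h0l]
      have hcl : c (Fin.last s) = 1 := by
        simp [c, Equiv.swap_apply_of_ne_of_ne h0l.symm h1l.symm]
      have e := hτ3 v
      have e₁ := hR c v
      have e₂ := hR (c * c) v
      simp only [Equiv.Perm.mul_apply, hc0, hcl, hc1] at e₁ e₂
      have e₃ := separatingSum_cyclic (A := A₀) hanti 0 (Fin.last s) 1 v
      change R v + _ + _ = 0 at e₃
      simp only [_root_.sub_apply, e₁, e₂]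
      linarith)
  let a : V →ₗ[ℝ] W :=
    { toFun := fun x => A 1 fun _ => x
      map_add' := fun x y => by
        have h := (A 1).map_update_add (fun _ => 0) 0 x y
        simp only [Function.update_eq_const_of_subsingleton] at h
        exact h
      map_smul' := fun c x => by
        have h := (A 1).map_update_smul (fun _ => 0) 0 c x
        simp only [Function.update_eq_const_of_subsingleton] at h
        exact h }
  obtain ⟨g, hg⟩ := exists_dual_section hanti hnond (a := a) hA1
  have hga : ∀ φ x, ω (A 1 fun _ => x) (g φ) = φ x := hg
  let As : MultilinearMap ℝ (fun _ : Fin s => V) W := g.compMultilinearMap B.curryRight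
  have hAs : ∀ (σ : Equiv.Perm (Fin s)) (m : Fin s → V), As (fun i => m (σ i)) = As m := by
    intro σ m
    change g (B.curryRight _) = g (B.curryRight _)
    congr 1
    ext x
    simp only [MultilinearMap.curryRight_apply]
    let π : Equiv.Perm (Fin (s + 1)) :=
      (finSuccEquivLast.trans σ.optionCongr).trans finSuccEquivLast.symm
    rw [← hBsym (Fin.snoc m x) π (by simp [π])]
    congr 1
    funext i
    refine Fin.lastCases ?_ (fun j => ?_) i <;> simp [π]
  refine ⟨As, hAs, fun v => ?_⟩
  have e₁ : ω (A 1 fun _ => v 0) (As fun i => v i.succ) =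
      B (fun i => v (Equiv.swap 0 (Fin.last s) i)) := by
    change ω _ (g (B.curryRight _)) = _
    rw [hga, MultilinearMap.curryRight_apply]
    let π : Equiv.Perm (Fin (s + 1)) := Equiv.swap 0 (Fin.last s) * finRotate (s + 1)
    rw [← hBsym (fun i => v (Equiv.swap 0 (Fin.last s) i)) π (by simp [π])]
    congr 1
    funext i
    refine Fin.lastCases ?_ (fun j => ?_) i <;> simp [π]
  have e₂ : ω (As fun i => v i.castSucc) (A 1 fun _ => v (Fin.last s)) = - B v := by
    rw [hanti]
    change - ω _ (g (B.curryRight _)) = _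
    rw [hga, MultilinearMap.curryRight_apply]
    congr 2
    funext i
    refine Fin.lastCases ?_ (fun j => ?_) i <;> simp
  have e₃ := hB v
  rw [_root_.sub_apply] at e₃
  rw [tauForm_eq_separatingSum ω hs (hA.update hAs), separatingSum_update ω hs hA hAs, e₁, e₂]
  change R v + _ + _ = _
  linarith
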